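/- Let G and H be groups and let a : G → H and b : H → G be injective group homomorphisms. Then the descending HNN extensions G∗_{b∘a} and H∗_{a∘b} are isomorphic; an isomorphism is given by sending each x ∈ G to a(x) ∈ H ⊆ H∗_{a∘b} and the stable letter of G∗_{b∘a} to the stable letter of H∗_{a∘b}. -/

import Mathlib

/-- The isomorphism `g.range ≃* ⊤` whose inverse sends `x ∈ G = ⊤` to `g x ∈ g.range`,
for an injective endomorphism `g : G →* G`. -/
noncomputable def descHNNEquiv {G : Type*} [Group G] (g : G →* G)
    (hg : Function.Injective g) : (g.range : Subgroup G) ≃* (⊤ : Subgroup G) :=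
  (MonoidHom.ofInjective hg).symm.trans Subgroup.topEquiv.symm

/-- The descending HNN extension `G∗_g` of a group `G` along an injective endomorphism
`g : G →* G`: the group `⟨G, t ∣ t⁻¹ x t = g x for all x ∈ G⟩`. -/
noncomputable def DescHNN (G : Type*) [Group G] (g : G →* G) (hg : Function.Injective g) :
    Type _ :=
  HNNExtension G g.range ⊤ (descHNNEquiv g hg)

noncomputable instance {G : Type*} [Group G] (g : G →* G) (hg : Function.Injective g) :
    Group (DescHNN G g hg) :=
  inferInstanceAs (Group (HNNExtension G g.range ⊤ (descHNNEquiv g hg)))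

/-- The canonical map `G →* G∗_g`. -/
noncomputable def DescHNN.of {G : Type*} [Group G] {g : G →* G} {hg : Function.Injective g} :
    G →* DescHNN G g hg :=
  HNNExtension.of

/-- The stable letter of `G∗_g`; it satisfies `t⁻¹ * of x * t = of (g x)`. -/
noncomputable def DescHNN.t {G : Type*} [Group G] {g : G →* G} {hg : Function.Injective g} :
    DescHNN G g hg :=
  HNNExtension.t

namespace DescHNN

variable {G K : Type*} [Group G] [Group K] {g : G →* G} {hg : Function.Injective g}

theorem of_mul_t (x : G) : (of x : DescHNN G g hg) * t = t * of (g x) :=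
  HNNExtension.of_mul_t (φ := descHNNEquiv g hg) ⟨x, Subgroup.mem_top x⟩

theorem t_mul_of_mul_inv_t (x : G) : (t : DescHNN G g hg) * of (g x) * t⁻¹ = of x := by
  rw [← of_mul_t, mul_inv_cancel_right]

/-- The homomorphism out of `G∗_g` given by its values on `G` and on the stable letter. -/
noncomputable def lift (f : G →* K) (s : K) (h : ∀ x, f x * s = s * f (g x)) :
    DescHNN G g hg →* K :=
  HNNExtension.lift f s fun y => by
    obtain ⟨x, rfl⟩ := (MonoidHom.ofInjective hg).surjective y
    simpa [descHNNEquiv, MonoidHom.ofInjective_apply] using (h x).symm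

@[simp]
theorem lift_of (f : G →* K) (s : K) (h : ∀ x, f x * s = s * f (g x)) (x : G) :
    lift (hg := hg) f s h (of x) = f x :=
  HNNExtension.lift_of ..

@[simp]
theorem lift_t (f : G →* K) (s : K) (h : ∀ x, f x * s = s * f (g x)) :
    lift (hg := hg) f s h t = s :=
  HNNExtension.lift_t ..

theorem hom_ext {f f' : DescHNN G g hg →* K} (hof : ∀ x, f (of x) = f' (of x))
    (ht : f t = f' t) : f = f' :=
  HNNExtension.hom_ext (MonoidHom.ext hof) ht

end DescHNN

/-- If `a : G → H` and `b : H → G` are injective group homomorphisms, then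
`G∗_{b∘a} ≅ H∗_{a∘b}`, via an isomorphism sending each `x ∈ G` to `a x ∈ H` and the stable
letter to the stable letter. -/
theorem descHNN_comp_mulEquiv {G H : Type*} [Group G] [Group H]
    (a : G →* H) (b : H →* G) (ha : Function.Injective a) (hb : Function.Injective b) :
    ∃ e : DescHNN G (b.comp a) (hb.comp ha) ≃* DescHNN H (a.comp b) (ha.comp hb),
      (∀ x : G, e (DescHNN.of x) = DescHNN.of (a x)) ∧ e DescHNN.t = DescHNN.t := by
  let F : DescHNN G (b.comp a) (hb.comp ha) →* DescHNN H (a.comp b) (ha.comp hb) :=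
    DescHNN.lift (DescHNN.of.comp a) DescHNN.t fun x => DescHNN.of_mul_t (a x)
  let F' : DescHNN H (a.comp b) (ha.comp hb) →* DescHNN G (b.comp a) (hb.comp ha) :=
    DescHNN.lift ((MulAut.conj DescHNN.t).toMonoidHom.comp (DescHNN.of.comp b)) DescHNN.t
      fun y => by
        have h := DescHNN.t_mul_of_mul_inv_t (g := b.comp a) (hg := hb.comp ha) (b y)
        simp only [MonoidHom.comp_apply] at h
        simp [h]
  refine ⟨F.toMulEquiv F' (DescHNN.hom_ext (fun x => ?_) ?_) (DescHNN.hom_ext (fun y => ?_) ?_),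
    fun x => ?_, ?_⟩
  · simpa [F, F'] using DescHNN.t_mul_of_mul_inv_t (g := b.comp a) (hg := hb.comp ha) x
  · simp [F, F']
  · simpa [F, F'] using DescHNN.t_mul_of_mul_inv_t (g := a.comp b) (hg := ha.comp hb) y
  · simp [F, F']
  · simp [F]
  · simp [F]
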